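/- Let Q denote the Minkowski quadratic form on ℝ⁴: Q(x) = −x₀² + x₁² + x₂² + x₃², and for integrable functions f, g : ℝ⁴ → ℝ define C(f,g) = ∫∫_{ℝ⁴×ℝ⁴} f(x) · g(y) · sgn(x₀ − y₀) · 1_{Q(x−y) < 0} dx dy. Let p, q ∈ ℝ⁴ with Q(p − q) < 0 and p₀ > q₀. Then there exists ε > 0 such that for all nonnegative integrable f, g : ℝ⁴ → ℝ with ∫ f = ∫ g = 1, with the support of f contained in the closed Euclidean ball of radius ε around p and the support of g contained in the closed Euclidean ball of radius ε around q, one has C(f,g) = 1. -/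

import Mathlib

open Real MeasureTheory

/-- The Minkowski quadratic form on `ℝ⁴`. -/
noncomputable def minkQ (x : EuclideanSpace ℝ (Fin 4)) : ℝ :=
  -(x 0) ^ 2 + (x 1) ^ 2 + (x 2) ^ 2 + (x 3) ^ 2

/-- The causal functional `C(f,g)`. -/
noncomputable def causalC (f g : EuclideanSpace ℝ (Fin 4) → ℝ) : ℝ :=
  ∫ x : EuclideanSpace ℝ (Fin 4), ∫ y : EuclideanSpace ℝ (Fin 4),
    f x * g y * Real.sign (x 0 - y 0) * (if minkQ (x - y) < 0 then (1 : ℝ) else 0)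

theorem continuous_minkQ : Continuous minkQ := by
  unfold minkQ
  fun_prop

theorem causalC_eq_integral_mul_integral (f g : EuclideanSpace ℝ (Fin 4) → ℝ)
    (h : ∀ x ∈ Function.support f, ∀ y ∈ Function.support g, y 0 < x 0 ∧ minkQ (x - y) < 0) :
    causalC f g = (∫ x, f x) * ∫ y, g y := by
  have key : ∀ x y, f x * g y * Real.sign (x 0 - y 0) *
      (if minkQ (x - y) < 0 then (1 : ℝ) else 0) = f x * g y := by
    intro x y
    by_cases hx : f x = 0
    · simp [hx]
    by_cases hy : g y = 0
    · simp [hy]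
    obtain ⟨h0, hQ⟩ := h x hx y hy
    rw [Real.sign_of_pos (sub_pos.2 h0), if_pos hQ, mul_one, mul_one]
  simp only [causalC, key, integral_const_mul, integral_mul_const]

theorem exists_closedBall_timelike_future {p q : EuclideanSpace ℝ (Fin 4)}
    (hpq : minkQ (p - q) < 0) (hpq0 : q 0 < p 0) :
    ∃ ε > (0 : ℝ), ∀ x ∈ Metric.closedBall p ε, ∀ y ∈ Metric.closedBall q ε,
      y 0 < x 0 ∧ minkQ (x - y) < 0 := by
  have hopen : IsOpen {z : EuclideanSpace ℝ (Fin 4) × EuclideanSpace ℝ (Fin 4) |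
      z.2 0 < z.1 0 ∧ minkQ (z.1 - z.2) < 0} := by
    rw [Set.ofPred_and]
    exact (isOpen_lt (by fun_prop) (by fun_prop)).inter
      (isOpen_lt (continuous_minkQ.comp (continuous_fst.sub continuous_snd)) continuous_const)
  obtain ⟨ε, hε, hsub⟩ := Metric.nhds_basis_closedBall.mem_iff.1
    (hopen.mem_nhds (show (p, q) ∈ _ from ⟨hpq0, hpq⟩))
  refine ⟨ε, hε, fun x hx y hy => hsub (?_ : (x, y) ∈ Metric.closedBall (p, q) ε)⟩
  rw [← closedBall_prod_same]
  exact ⟨hx, hy⟩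

/-- Strict localization, timelike case: if `p` is timelike separated from and in the
future of `q`, then for sharply enough localized normalized test functions the causal
functional equals `1`. -/
theorem causalC_eq_one_of_timelike_future
    (p q : EuclideanSpace ℝ (Fin 4)) (hpq : minkQ (p - q) < 0) (hpq0 : q 0 < p 0) :
    ∃ ε > (0 : ℝ), ∀ f g : EuclideanSpace ℝ (Fin 4) → ℝ,
      Integrable f → Integrable g →
      (∀ x, 0 ≤ f x) → (∀ x, 0 ≤ g x) →
      (∫ x, f x) = 1 → (∫ x, g x) = 1 →
      Function.support f ⊆ Metric.closedBall p ε →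
      Function.support g ⊆ Metric.closedBall q ε →
      causalC f g = 1 := by
  obtain ⟨ε, hε, h⟩ := exists_closedBall_timelike_future hpq hpq0
  refine ⟨ε, hε, fun f g _ _ _ _ hf hg hfs hgs => ?_⟩
  rw [causalC_eq_integral_mul_integral f g fun x hx y hy => h x (hfs hx) y (hgs hy),
    hf, hg, mul_one]
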